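/- arXiv:1506.04347 — 2 statements merged into one kernel-verified Lean document; each statement's English description precedes it below -/
import Mathlib

section
/- Let P_G be the cone of 3×3 positive definite matrices K with k₁₃ = k₂₃. For δ > 0 and D in the dual cone (i.e. d₁₃ = d₂₃, d₁₁, d₂₂, d₃₃ > 0, d₁₂² < d₁₁d₂₂, 4d₁₃² < (d₁₁+d₂₂+2d₁₂)d₃₃), the integral I(δ, D) = ∫_{P_G} |K|^{(δ-2)/2} exp(-(1/2) tr(KD)) dK equals 2^{(3δ+4)/2} π Γ(δ/2) Γ((δ+1)/2)² (d₁₁+d₂₂+2d₁₂)^{δ/2} [d₃₃(d₁₁+d₂₂+2d₁₂) - 4d₁₃²]^{-(δ+1)/2} (d₁₁d₂₂ - d₁₂²)^{-(δ+1)/2}. -/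
open Matrix Real MeasureTheory

/-- The symmetric 3×3 matrix with free coordinates `(k₁₁, k₁₂, k₁₃, k₂₂, k₃₃)` and
the colouring constraint `k₁₃ = k₂₃`. -/
noncomputable def toK (v : Fin 5 → ℝ) : Matrix (Fin 3) (Fin 3) ℝ :=
  !![v 0, v 1, v 2; v 1, v 3, v 2; v 2, v 2, v 4]

lemma L_gamma {q r C : ℝ} (hq : 0 < q) (hr : 0 < r) (hC : 0 ≤ C) (m : ℝ) :
    ∫⁻ z : ℝ, ENNReal.ofReal (if m < z then C * ((z - m) ^ (q - 1) * Real.exp (-(r * (z - m)))) else 0)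
      = ENNReal.ofReal (C * ((1 / r) ^ q * Real.Gamma q)) := by
  rw [← lintegral_add_right_eq_self _ m]
  simp only [add_sub_cancel_right, lt_add_iff_pos_left]
  have key := Real.integral_rpow_mul_exp_neg_mul_Ioi hq hr
  have hG := Real.Gamma_pos_of_pos hq
  have hint : IntegrableOn (fun x ↦ x ^ (q - 1) * rexp (-(r * x))) (Set.Ioi 0) :=
    .of_integral_ne_zero (by rw [key]; positivity)
  rw [← key, ← integral_const_mul, ofReal_integral_eq_lintegral_ofReal (hint.const_mul C),
    ← lintegral_indicator measurableSet_Ioi]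
  · refine lintegral_congr fun z => ?_
    by_cases hz : 0 < z <;> simp [Set.indicator, hz]
  · filter_upwards [self_mem_ae_restrict measurableSet_Ioi] with z hz
    have : 0 < z := hz
    show 0 ≤ C * _
    positivity

lemma L_gauss {A C : ℝ} (hA : 0 < A) (hC : 0 ≤ C) (B : ℝ) :
    ∫⁻ x : ℝ, ENNReal.ofReal (C * Real.exp (-A * x ^ 2 - B * x))
      = ENNReal.ofReal (C * (√(π / A) * Real.exp (B ^ 2 / (4 * A)))) := by
  rw [← lintegral_add_right_eq_self _ (-(B / (2 * A)))]
  have h : ∀ x : ℝ, C * Real.exp (-A * (x + -(B / (2 * A))) ^ 2 - B * (x + -(B / (2 * A))))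
      = (C * Real.exp (B ^ 2 / (4 * A))) * Real.exp (-A * x ^ 2) := by
    intro x
    rw [mul_assoc, ← Real.exp_add]
    congr 2
    field_simp
    ring
  simp only [h]
  rw [← ofReal_integral_eq_lintegral_ofReal ((integrable_exp_neg_mul_sq hA).const_mul _)
    (Filter.Eventually.of_forall fun x => by
      show 0 ≤ C * _ * _
      positivity), integral_const_mul, integral_gaussian]
  congr 1
  ring

lemma lint_cons {n : ℕ} (f : (Fin (n + 1) → ℝ) → ENNReal) (hf : Measurable f) :
    ∫⁻ v, f v = ∫⁻ x : ℝ, ∫⁻ v : Fin n → ℝ, f (Fin.cons x v) := by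
  rw [← ((volume_preserving_piFinSuccAbove (fun _ : Fin (n + 1) => ℝ) 0).symm).lintegral_comp hf,
    Measure.volume_eq_prod, lintegral_prod]
  · simp [MeasurableEquiv.piFinSuccAbove_symm_apply, Fin.insertNthEquiv]
  · exact (hf.comp (MeasurableEquiv.measurable _)).aemeasurable

lemma lint_five (f : (Fin 5 → ℝ) → ENNReal) (hf : Measurable f) :
    ∫⁻ v, f v = ∫⁻ a : ℝ, ∫⁻ b : ℝ, ∫⁻ c : ℝ, ∫⁻ x : ℝ, ∫⁻ z : ℝ, f ![a, b, c, x, z] := by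
  have hc : ∀ (n : ℕ) (a : ℝ), Measurable (fun v : Fin n → ℝ => (Fin.cons a v : Fin (n+1) → ℝ)) := by
    intro n a
    refine measurable_pi_iff.2 fun i => ?_
    refine Fin.cases ?_ (fun j => ?_) i
    · simp
    · simpa using measurable_pi_apply j
  rw [lint_cons f hf]
  refine lintegral_congr fun a => ?_
  refine (lint_cons _ (hf.comp (hc _ a))).trans ?_
  refine lintegral_congr fun b => ?_
  refine (lint_cons _ ((hf.comp (hc _ a)).comp (hc _ b))).trans ?_
  refine lintegral_congr fun c => ?_
  refine (lint_cons _ (((hf.comp (hc _ a)).comp (hc _ b)).comp (hc _ c))).trans ?_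
  refine lintegral_congr fun x => ?_
  refine (lint_cons _ ((((hf.comp (hc _ a)).comp (hc _ b)).comp (hc _ c)).comp (hc _ x))).trans ?_
  refine lintegral_congr fun z => ?_
  rw [lintegral_unique]
  have hv : (volume : Measure (Fin 0 → ℝ)) Set.univ = 1 := by
    rw [volume_pi, Measure.pi_univ]
    simp
  rw [hv, mul_one]
  show f _ = f _
  congr 1

/-- integrand in adapted coordinates -/
noncomputable def GG (p d1 e S g d a b c x z : ℝ) : ℝ :=
  if 0 < a then if b ^ 2 / a < c then if x ^ 2 / (c - b ^ 2 / a) < z then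
    (a * (c - b ^ 2 / a) * (z - x ^ 2 / (c - b ^ 2 / a))) ^ p *
      Real.exp (-(1/2) * (d1 * a + 2 * e * b + S * c + 4 * g * x + d * z))
    else 0 else 0 else 0

lemma GG_nonneg (p d1 e S g d a b c x z : ℝ) : 0 ≤ GG p d1 e S g d a b c x z := by
  unfold GG
  split_ifs with h1 h2 h3
  · have := sub_pos.2 h2
    have := sub_pos.2 h3
    positivity
  all_goals exact le_rfl

lemma GG_meas (p d1 e S g d : ℝ) {α : Type*} [MeasurableSpace α] {a b c x z : α → ℝ}
    (ha : Measurable a) (hb : Measurable b) (hc : Measurable c) (hx : Measurable x)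
    (hz : Measurable z) :
    Measurable fun v => GG p d1 e S g d (a v) (b v) (c v) (x v) (z v) := by
  unfold GG
  refine Measurable.ite (measurableSet_lt (by fun_prop) (by fun_prop)) ?_ measurable_const
  refine Measurable.ite (measurableSet_lt (by fun_prop) (by fun_prop)) ?_ measurable_const
  refine Measurable.ite (measurableSet_lt (by fun_prop) (by fun_prop)) ?_ measurable_const
  fun_prop

lemma step_z (δ d1 e S g d a b c x : ℝ) (hδ : 0 < δ) (hd : 0 < d) :
    ∫⁻ z : ℝ, ENNReal.ofReal (GG ((δ - 2)/2) d1 e S g d a b c x z) =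
    ENNReal.ofReal (if 0 < a then if b ^ 2 / a < c then
      ((a * (c - b ^ 2 / a)) ^ ((δ - 2)/2) * Real.exp (-(1/2) * (d1 * a + 2 * e * b + S * c)) *
        ((1 / (d / 2)) ^ (δ / 2) * Real.Gamma (δ / 2))) *
        Real.exp (-(d / (2 * (c - b ^ 2 / a))) * x ^ 2 - 2 * g * x) else 0 else 0) := by
  by_cases ha : 0 < a
  swap
  · simp [GG, ha]
  by_cases hc : b ^ 2 / a < c
  swap
  · simp [GG, hc]
  simp only [GG, ha, hc, if_true]
  have hw := sub_pos.2 hc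
  set w := c - b ^ 2 / a with hwdef
  have := L_gamma (q := δ / 2) (r := d / 2) (C := (a * w) ^ ((δ - 2)/2) * Real.exp (-(1/2) * (d1 * a + 2 * e * b + S * c)) * Real.exp (-(d / (2 * w)) * x ^ 2 - 2 * g * x)) (by positivity) (by positivity) (by positivity) (x ^ 2 / w)
  rw [show ∀ A B C D : ℝ, A * B * C * D = A * B * D * C by intros; ring, ← this]
  refine lintegral_congr fun z => ?_
  congr 1
  split_ifs with hz
  · rw [Real.mul_rpow (by positivity) (sub_pos.2 hz).le, show δ / 2 - 1 = (δ - 2)/2 by ring]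
    have : rexp (-(1 / 2) * (d1 * a + 2 * e * b + S * c + 4 * g * x + d * z)) = Real.exp (-(1/2) * (d1 * a + 2 * e * b + S * c)) * Real.exp (-(d / (2 * w)) * x ^ 2 - 2 * g * x) * Real.exp (-(d / 2 * (z - x ^ 2 / w))) := by
      rw [← Real.exp_add, ← Real.exp_add]
      congr 1
      field_simp
      ring
    rw [this]
    ring
  · rfl

lemma step_x (δ d1 e S g d a b c : ℝ) (hδ : 0 < δ) (hd : 0 < d) :
    ∫⁻ x : ℝ, ∫⁻ z : ℝ, ENNReal.ofReal (GG ((δ - 2)/2) d1 e S g d a b c x z) =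
    ENNReal.ofReal (if 0 < a then if b ^ 2 / a < c then
      ((a * (c - b ^ 2 / a)) ^ ((δ - 2)/2) * Real.exp (-(1/2) * (d1 * a + 2 * e * b + S * c)) *
        ((1 / (d / 2)) ^ (δ / 2) * Real.Gamma (δ / 2))) *
        (√(π / (d / (2 * (c - b ^ 2 / a)))) *
          Real.exp ((2 * g) ^ 2 / (4 * (d / (2 * (c - b ^ 2 / a)))))) else 0 else 0) := by
  simp only [step_z δ d1 e S g d a b c _ hδ hd]
  have hG := Real.Gamma_pos_of_pos (half_pos hδ)
  by_cases ha : 0 < a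
  swap
  · simp [ha]
  by_cases hc : b ^ 2 / a < c
  swap
  · simp [hc]
  simp only [ha, hc, if_true]
  have hw := sub_pos.2 hc
  rw [L_gauss (by positivity) (by positivity)]

lemma step_c (δ d1 e S g d a b : ℝ) (hδ : 0 < δ) (hd : 0 < d) (hg : 0 < S - 4 * g ^ 2 / d) :
    ∫⁻ c : ℝ, ∫⁻ x : ℝ, ∫⁻ z : ℝ, ENNReal.ofReal (GG ((δ - 2)/2) d1 e S g d a b c x z) =
    ENNReal.ofReal (if 0 < a then
      (a ^ ((δ - 2)/2) * Real.exp (-(1/2) * (d1 * a)) *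
        ((1 / (d / 2)) ^ (δ / 2) * Real.Gamma (δ / 2)) * √(2 * π / d) *
        ((1 / ((S - 4 * g ^ 2 / d) / 2)) ^ ((δ + 1) / 2) * Real.Gamma ((δ + 1) / 2))) *
          Real.exp (-(S / (2 * a)) * b ^ 2 - e * b) else 0) := by
  simp only [step_x δ d1 e S g d a b _ hδ hd]
  have hG := Real.Gamma_pos_of_pos (half_pos hδ)
  by_cases ha : 0 < a
  swap
  · simp [ha]
  simp only [ha, if_true]
  have := L_gamma (q := (δ + 1) / 2) (r := (S - 4 * g ^ 2 / d) / 2) (C := a ^ ((δ - 2)/2) * Real.exp (-(1/2) * (d1 * a)) *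
        ((1 / (d / 2)) ^ (δ / 2) * Real.Gamma (δ / 2)) * √(2 * π / d) * Real.exp (-(S / (2 * a)) * b ^ 2 - e * b)) (by positivity) (by positivity) (by positivity) (b ^ 2 / a)
  rw [show ∀ A B C D E F : ℝ, A * B * C * D * E * F = A * B * C * D * F * E by intros; ring, ← this]
  refine lintegral_congr fun c => ?_
  congr 1
  split_ifs with hc
  swap
  · rfl
  have hw := sub_pos.2 hc
  set w := c - b ^ 2 / a with hwdef
  have hcw : c = w + b ^ 2 / a := by rw [hwdef]; ring
  have h1 : √(π / (d / (2 * w))) = √(2 * π / d) * w ^ (1/2 : ℝ) := by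
    rw [← Real.sqrt_eq_rpow, ← Real.sqrt_mul (by positivity)]
    congr 1
    field_simp
  have h2 : w ^ ((δ + 1) / 2 - 1) = w ^ ((δ - 2)/2) * w ^ (1/2 : ℝ) := by
    rw [← Real.rpow_add hw]
    congr 1
    ring
  have h3 : rexp (-(1 / 2) * (d1 * a + 2 * e * b + S * c)) * rexp ((2 * g) ^ 2 / (4 * (d / (2 * w)))) = Real.exp (-(1/2) * (d1 * a)) * Real.exp (-(S / (2 * a)) * b ^ 2 - e * b) * rexp (-((S - 4 * g ^ 2 / d) / 2 * w)) := by
    rw [← Real.exp_add, ← Real.exp_add, ← Real.exp_add]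
    congr 1
    rw [hcw]
    field_simp
    ring
  rw [h1, h2, Real.mul_rpow ha.le hw.le]
  linear_combination (a ^ ((δ - 2)/2) * w ^ ((δ - 2)/2) * ((1 / (d / 2)) ^ (δ / 2) * Real.Gamma (δ / 2)) * (√(2 * π / d) * w ^ (1/2 : ℝ))) * h3

lemma step_b (δ d1 e S g d a : ℝ) (hδ : 0 < δ) (hd : 0 < d) (hS : 0 < S) (hg : 0 < S - 4 * g ^ 2 / d) :
    ∫⁻ b : ℝ, ∫⁻ c : ℝ, ∫⁻ x : ℝ, ∫⁻ z : ℝ,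
      ENNReal.ofReal (GG ((δ - 2)/2) d1 e S g d a b c x z) =
    ENNReal.ofReal (if 0 < a then
      (a ^ ((δ - 2)/2) * Real.exp (-(1/2) * (d1 * a)) *
        ((1 / (d / 2)) ^ (δ / 2) * Real.Gamma (δ / 2)) * √(2 * π / d) *
        ((1 / ((S - 4 * g ^ 2 / d) / 2)) ^ ((δ + 1) / 2) * Real.Gamma ((δ + 1) / 2))) *
          (√(π / (S / (2 * a))) * Real.exp (e ^ 2 / (4 * (S / (2 * a))))) else 0) := by
  simp only [step_c δ d1 e S g d a _ hδ hd hg]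
  have hG := Real.Gamma_pos_of_pos (half_pos hδ)
  have hG := Real.Gamma_pos_of_pos (show 0 < (δ + 1) / 2 by positivity)
  by_cases ha : 0 < a
  swap
  · simp [ha]
  simp only [ha, if_true]
  rw [L_gauss (by positivity) (by positivity)]

lemma step_a (δ d1 e S g d : ℝ) (hδ : 0 < δ) (hd : 0 < d) (hS : 0 < S) (hg : 0 < S - 4 * g ^ 2 / d)
    (he : 0 < d1 - e ^ 2 / S) :
    ∫⁻ a : ℝ, ∫⁻ b : ℝ, ∫⁻ c : ℝ, ∫⁻ x : ℝ, ∫⁻ z : ℝ,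
      ENNReal.ofReal (GG ((δ - 2)/2) d1 e S g d a b c x z) =
    ENNReal.ofReal (
        ((1 / (d / 2)) ^ (δ / 2) * Real.Gamma (δ / 2)) * √(2 * π / d) *
        ((1 / ((S - 4 * g ^ 2 / d) / 2)) ^ ((δ + 1) / 2) * Real.Gamma ((δ + 1) / 2)) *
        √(2 * π / S) *
        ((1 / ((d1 - e ^ 2 / S) / 2)) ^ ((δ + 1) / 2) * Real.Gamma ((δ + 1) / 2))) := by
  simp only [step_b δ d1 e S g d _ hδ hd hS hg]
  have hG := Real.Gamma_pos_of_pos (half_pos hδ)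
  have hG := Real.Gamma_pos_of_pos (show 0 < (δ + 1) / 2 by positivity)
  rw [← L_gamma (q := (δ + 1) / 2) (r := (d1 - e ^ 2 / S) / 2) (by positivity) (by positivity) (by positivity) 0]
  refine lintegral_congr fun a => ?_
  congr 1
  split_ifs with ha
  swap
  · rfl
  rw [sub_zero]
  have h1 : √(π / (S / (2 * a))) = √(2 * π / S) * a ^ (1/2 : ℝ) := by
    rw [← Real.sqrt_eq_rpow, ← Real.sqrt_mul (by positivity)]
    congr 1
    field_simp
  have h2 : a ^ ((δ + 1) / 2 - 1) = a ^ ((δ - 2)/2) * a ^ (1/2 : ℝ) := by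
    rw [← Real.rpow_add ha]
    congr 1
    ring
  have h3 : rexp (-(1 / 2) * (d1 * a)) * rexp (e ^ 2 / (4 * (S / (2 * a)))) = rexp (-((d1 - e ^ 2 / S) / 2 * a)) := by
    rw [← Real.exp_add]
    congr 1
    field_simp
    ring
  rw [h1, h2, ← h3]
  ring

lemma quad (v : Fin 5 → ℝ) (y : Fin 3 → ℝ) {a b c w t : ℝ} (ha : a = v 0 - 2 * v 1 + v 3)
    (hb : b = v 1 - v 3) (hc : c = v 3) (hw : w = c - b ^ 2 / a) (ht : t = v 4 - v 2 ^ 2 / w)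
    (ha0 : a ≠ 0) (hw0 : w ≠ 0) :
    star y ⬝ᵥ (toK v *ᵥ y) = a * (y 0 + b * (y 0 + y 1) / a) ^ 2 +
      w * (y 0 + y 1 + v 2 * y 2 / w) ^ 2 + t * y 2 ^ 2 := by
  have e1 : star y ⬝ᵥ (toK v *ᵥ y) = a * y 0 ^ 2 + 2 * b * y 0 * (y 0 + y 1) + c * (y 0 + y 1) ^ 2
      + 2 * v 2 * y 2 * (y 0 + y 1) + v 4 * y 2 ^ 2 := by
    subst ha hb hc
    simp [toK, dotProduct, mulVec, Fin.sum_univ_succ]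
    ring
  have e2 : a * (y 0 + b * (y 0 + y 1) / a) ^ 2 = a * y 0 ^ 2 + 2 * b * y 0 * (y 0 + y 1) + b ^ 2 / a * (y 0 + y 1) ^ 2 := by
    field_simp
    ring
  have e3 : w * (y 0 + y 1 + v 2 * y 2 / w) ^ 2 = w * (y 0 + y 1) ^ 2 + 2 * v 2 * y 2 * (y 0 + y 1) + v 2 ^ 2 / w * y 2 ^ 2 := by
    field_simp
    ring
  rw [e1, e2, e3, ht]
  rw [show c = w + b ^ 2 / a by rw [hw]; ring]
  ring

lemma posDef_iff' (v : Fin 5 → ℝ) {a b c w t : ℝ} (ha : a = v 0 - 2 * v 1 + v 3)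
    (hb : b = v 1 - v 3) (hc : c = v 3) (hw : w = c - b ^ 2 / a) (ht : t = v 4 - v 2 ^ 2 / w) :
    (toK v).PosDef ↔ 0 < a ∧ 0 < w ∧ 0 < t := by
  constructor
  · intro h
    have ha0 : 0 < a := by
      have := h.dotProduct_mulVec_pos (x := ![1, -1, 0]) (by
        intro h0; simpa using congrFun h0 0)
      simp [toK, dotProduct, mulVec, Fin.sum_univ_succ] at this
      linarith
    have hw0 : 0 < w := by
      have := h.dotProduct_mulVec_pos (x := ![-b / a, 1 + b / a, 0]) (by
        intro h0
        have h1 := congrFun h0 0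
        have h2 := congrFun h0 1
        simp at h1 h2
        rcases h1 with h1 | h1 <;> simp [h1] at h2)
      have e : star ![-b / a, 1 + b / a, 0] ⬝ᵥ (toK v *ᵥ ![-b / a, 1 + b / a, 0]) = w := by
        have e1 : star ![-b / a, 1 + b / a, 0] ⬝ᵥ (toK v *ᵥ ![-b / a, 1 + b / a, 0])
          = a * (-b / a) ^ 2 + 2 * b * (-b / a) + c := by
          rw [hc]
          nth_rw 6 [hb]
          rw [show a * (-b / a) ^ 2 = (v 0 - 2 * v 1 + v 3) * (-b / a) ^ 2 by rw [← ha]]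
          simp [toK, dotProduct, mulVec, Fin.sum_univ_succ]
          ring
        rw [e1, hw]
        field_simp
        ring
      rwa [e] at this
    refine ⟨ha0, hw0, ?_⟩
    have := h.dotProduct_mulVec_pos
      (x := ![-(b * (-v 2 / w) / a), -v 2 / w + b * (-v 2 / w) / a, 1]) (by
        intro h0; simpa using congrFun h0 2)
    rw [quad v _ ha hb hc hw ht ha0.ne' hw0.ne'] at this
    simp at this
    ring_nf at this
    linarith
  · rintro ⟨ha0, hw0, ht0⟩
    refine PosDef.of_dotProduct_mulVec_pos ?_ fun y hy => ?_
    · ext i j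
      fin_cases i <;> fin_cases j <;> simp [toK]
    · rw [quad v y ha hb hc hw ht ha0.ne' hw0.ne']
      by_contra hn
      have h1 : 0 ≤ a * (y 0 + b * (y 0 + y 1) / a) ^ 2 := by positivity
      have h2 : 0 ≤ w * (y 0 + y 1 + v 2 * y 2 / w) ^ 2 := by positivity
      have h3 : 0 ≤ t * y 2 ^ 2 := by positivity
      have k3 : t * y 2 ^ 2 = 0 := by linarith
      have k2 : w * (y 0 + y 1 + v 2 * y 2 / w) ^ 2 = 0 := by linarith
      have k1 : a * (y 0 + b * (y 0 + y 1) / a) ^ 2 = 0 := by linarith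
      simp only [mul_eq_zero, ha0.ne', hw0.ne', ht0.ne', false_or, pow_eq_zero_iff, ne_eq, OfNat.ofNat_ne_zero, not_false_eq_true] at k1 k2 k3
      rw [k3] at k2
      simp only [mul_zero, zero_div, add_zero] at k2
      rw [k2] at k1
      simp only [mul_zero, zero_div, add_zero] at k1
      apply hy
      ext i
      fin_cases i
      · exact k1
      · show y 1 = 0
        linarith
      · exact k3

lemma integrand_eq (p : ℝ) (D : Matrix (Fin 3) (Fin 3) ℝ) (hD : D.IsSymm) (hD13 : D 0 2 = D 1 2)
    (v : Fin 5 → ℝ) :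
    {v : Fin 5 → ℝ | (toK v).PosDef}.indicator (fun v => (toK v).det ^ p *
        Real.exp (-(1/2) * ((toK v) * D).trace)) v
      = GG p (D 0 0) (D 0 0 + D 0 1) (D 0 0 + D 1 1 + 2 * D 0 1) (D 0 2) (D 2 2)
        (v 0 - 2 * v 1 + v 3) (v 1 - v 3) (v 3) (v 2) (v 4) := by
  have hi := posDef_iff' v rfl rfl rfl rfl rfl
  rw [sub_pos, sub_pos] at hi
  by_cases h : (toK v).PosDef
  · have h' := hi.1 h
    rw [Set.indicator_of_mem (show v ∈ {v : Fin 5 → ℝ | (toK v).PosDef} from h), GG, if_pos h'.1, if_pos h'.2.1, if_pos h'.2.2]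
    have h1 := h'.1.ne'
    have h2 := (sub_pos.2 h'.2.1).ne'
    congr 2
    · set w := v 3 - (v 1 - v 3) ^ 2 / (v 0 - 2 * v 1 + v 3) with hw
      have hw' : (v 0 - 2 * v 1 + v 3) * w = (v 0 - 2 * v 1 + v 3) * v 3 - (v 1 - v 3) ^ 2 := by
        rw [hw]; field_simp
      have : (v 0 - 2 * v 1 + v 3) * w * (v 4 - v 2 ^ 2 / w) = (v 0 - 2 * v 1 + v 3) * w * v 4 - (v 0 - 2 * v 1 + v 3) * v 2 ^ 2 := by
        field_simp
      rw [this, hw', det_fin_three]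
      simp [toK]
      ring
    · congr 1
      have s1 := hD.apply 0 1
      have s2 := hD.apply 0 2
      have s3 := hD.apply 1 2
      simp only [trace, Matrix.diag, Matrix.mul_apply, Fin.sum_univ_three]
      simp [toK]
      rw [s1, s2, s3, ← hD13]
      ring
  · rw [Set.indicator_of_notMem (show ¬ v ∈ {v : Fin 5 → ℝ | (toK v).PosDef} from h), GG]
    split_ifs with h1 h2 h3
    · exact absurd (hi.2 ⟨h1, h2, h3⟩) h
    all_goals rfl

/-- the change of coordinates -/
noncomputable def MM : Matrix (Fin 5) (Fin 5) ℝ :=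
  !![1, -2, 0, 1, 0; 0, 1, 0, -1, 0; 0, 0, 0, 1, 0; 0, 0, 1, 0, 0; 0, 0, 0, 0, 1]

lemma MM_det : MM.det = -1 := by
  simp [MM, det_succ_row_zero, Fin.sum_univ_succ, Fin.succAbove]

lemma MM_pres : MeasurePreserving (toLin' MM) := by
  refine ⟨(LinearMap.continuous_of_finiteDimensional _).measurable, ?_⟩
  rw [Real.map_matrix_volume_pi_eq_smul_volume_pi (by rw [MM_det]; norm_num), MM_det]
  norm_num

lemma final (δ A B C g d : ℝ) (hδ : 0 < δ) (hd : 0 < d)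
    (hS : 0 < A + B + 2 * C) (h1 : 0 < d * (A + B + 2 * C) - 4 * g ^ 2) (h2 : 0 < A * B - C ^ 2) :
    ((1 / (d / 2)) ^ (δ / 2) * Real.Gamma (δ / 2)) * √(2 * π / d) *
        ((1 / (((A + B + 2 * C) - 4 * g ^ 2 / d) / 2)) ^ ((δ + 1) / 2) * Real.Gamma ((δ + 1) / 2)) *
        √(2 * π / (A + B + 2 * C)) *
        ((1 / ((A - (A + C) ^ 2 / (A + B + 2 * C)) / 2)) ^ ((δ + 1) / 2) * Real.Gamma ((δ + 1) / 2))
    = 2 ^ ((3*δ + 4)/2) * π * Real.Gamma (δ/2) * Real.Gamma ((δ+1)/2) ^ 2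
          * (A + B + 2 * C) ^ (δ/2)
          * (d * (A + B + 2 * C) - 4 * g^2) ^ (-(δ+1)/2)
          * (A * B - C^2) ^ (-(δ+1)/2) := by
  have e1 : 1 / (((A + B + 2 * C) - 4 * g ^ 2 / d) / 2) = 2 * d / (d * (A + B + 2 * C) - 4 * g ^ 2) := by
    rw [show (A + B + 2 * C) - 4 * g ^ 2 / d = (d * (A + B + 2 * C) - 4 * g ^ 2) / d by field_simp]
    field_simp
  have e2 : 1 / ((A - (A + C) ^ 2 / (A + B + 2 * C)) / 2) = 2 * (A + B + 2 * C) / (A * B - C ^ 2) := by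
    rw [show A - (A + C) ^ 2 / (A + B + 2 * C) = (A * B - C ^ 2) / (A + B + 2 * C) by
      rw [eq_div_iff hS.ne', sub_mul, div_mul_cancel₀ _ hS.ne']; ring]
    field_simp
  rw [e1, e2]
  generalize A * B - C ^ 2 = Δ at *
  generalize d * (A + B + 2 * C) - 4 * g ^ 2 = E at *
  generalize A + B + 2 * C = S at *
  rw [show 1 / (d / 2) = 2 / d by field_simp]
  rw [Real.div_rpow (by positivity) (by positivity), Real.div_rpow (by positivity) (by positivity),
    Real.div_rpow (by positivity) (by positivity), Real.mul_rpow (by positivity) (by positivity),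
    Real.mul_rpow (by positivity) (by positivity), neg_div, Real.rpow_neg h1.le, Real.rpow_neg h2.le]
  have e3 : √(2 * π / d) * √(2 * π / S) = 2 * π / (d ^ (1/2:ℝ) * S ^ (1/2 : ℝ)) := by
    rw [← Real.sqrt_eq_rpow, ← Real.sqrt_eq_rpow, Real.sqrt_div (by positivity),
      Real.sqrt_div (by positivity), div_mul_div_comm, Real.mul_self_sqrt (by positivity)]
  have e4 : ∀ x : ℝ, 0 < x → x ^ ((δ + 1) / 2) = x ^ (δ / 2) * x ^ (1/2 : ℝ) := by
    intro x hx
    rw [← Real.rpow_add hx]; congr 1; ring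
  have e5 : (2:ℝ) ^ ((3 * δ + 4) / 2) = 2 ^ (δ / 2) * 2 * 2 ^ ((δ + 1) / 2) * 2 ^ ((δ + 1) / 2) := by
    rw [show (2:ℝ) ^ (δ / 2) * 2 = 2 ^ (δ / 2) * 2 ^ (1:ℝ) by rw [Real.rpow_one]]
    rw [← Real.rpow_add two_pos, ← Real.rpow_add two_pos, ← Real.rpow_add two_pos]; congr 1; ring
  rw [show ∀ a b c d e : ℝ, a * b * c * d * e = a * c * e * (b * d) by intros; ring, e3, e5, e4 d hd, e4 S hS]
  have := Real.rpow_pos_of_pos hd (δ / 2)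
  have := Real.rpow_pos_of_pos hd (1 / 2)
  have := Real.rpow_pos_of_pos hS (1 / 2)
  have := Real.rpow_pos_of_pos h1 ((δ + 1) / 2)
  have := Real.rpow_pos_of_pos h2 ((δ + 1) / 2)
  generalize d ^ (δ / 2) = X1 at *
  generalize d ^ (1 / 2 : ℝ) = X2 at *
  generalize S ^ (1 / 2 : ℝ) = X3 at *
  generalize E ^ ((δ + 1) / 2) = X4 at *
  generalize Δ ^ ((δ + 1) / 2) = X5 at *
  generalize (2:ℝ) ^ ((δ + 1) / 2) = X6 at *
  generalize (2:ℝ) ^ (δ / 2) = X7 at *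
  field_simp

theorem normalizing_constant_triangle (δ : ℝ) (hδ : 0 < δ)
    (D : Matrix (Fin 3) (Fin 3) ℝ) (hD : D.IsSymm) (hD13 : D 0 2 = D 1 2)
    (h11 : 0 < D 0 0) (h22 : 0 < D 1 1) (h33 : 0 < D 2 2)
    (h12 : (D 0 1)^2 < D 0 0 * D 1 1)
    (h13 : 4 * (D 0 2)^2 < (D 0 0 + D 1 1 + 2 * D 0 1) * D 2 2) :
    ∫ v in {v : Fin 5 → ℝ | (toK v).PosDef},
        (toK v).det ^ ((δ - 2)/2) * Real.exp (-(1/2) * ((toK v) * D).trace)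
      = 2 ^ ((3*δ + 4)/2) * π * Real.Gamma (δ/2) * Real.Gamma ((δ+1)/2) ^ 2
          * (D 0 0 + D 1 1 + 2 * D 0 1) ^ (δ/2)
          * (D 2 2 * (D 0 0 + D 1 1 + 2 * D 0 1) - 4 * (D 0 2)^2) ^ (-(δ+1)/2)
          * (D 0 0 * D 1 1 - (D 0 1)^2) ^ (-(δ+1)/2) := by
  have hd0 := h11
  have hS : 0 < D 0 0 + D 1 1 + 2 * D 0 1 := by
    have : 0 < D 0 0 * (D 0 0 + D 1 1 + 2 * D 0 1) := by nlinarith [sq_nonneg (D 0 0 + D 0 1)]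
    exact pos_of_mul_pos_right this h11.le
  have k1 : 0 < D 2 2 * (D 0 0 + D 1 1 + 2 * D 0 1) - 4 * (D 0 2) ^ 2 := by linarith
  have k2 : 0 < D 0 0 * D 1 1 - (D 0 1) ^ 2 := by linarith
  have hg : 0 < (D 0 0 + D 1 1 + 2 * D 0 1) - 4 * (D 0 2) ^ 2 / D 2 2 := by
    rw [sub_pos, div_lt_iff₀ h33]
    linarith
  have he : 0 < D 0 0 - (D 0 0 + D 0 1) ^ 2 / (D 0 0 + D 1 1 + 2 * D 0 1) := by
    rw [sub_pos, div_lt_iff₀ hS]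
    nlinarith
  have hGm : Measurable fun v : Fin 5 → ℝ => GG ((δ - 2)/2) (D 0 0) (D 0 0 + D 0 1)
      (D 0 0 + D 1 1 + 2 * D 0 1) (D 0 2) (D 2 2)
        (v 0 - 2 * v 1 + v 3) (v 1 - v 3) (v 3) (v 2) (v 4) :=
    GG_meas _ _ _ _ _ _ (by fun_prop) (by fun_prop) (by fun_prop) (by fun_prop) (by fun_prop)
  have hGm2 : Measurable fun v : Fin 5 → ℝ => ENNReal.ofReal (GG ((δ - 2)/2) (D 0 0) (D 0 0 + D 0 1)
      (D 0 0 + D 1 1 + 2 * D 0 1) (D 0 2) (D 2 2) (v 0) (v 1) (v 2) (v 3) (v 4)) :=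
    (GG_meas _ _ _ _ _ _ (by fun_prop) (by fun_prop) (by fun_prop) (by fun_prop)
      (by fun_prop)).ennreal_ofReal
  have hms : MeasurableSet {v : Fin 5 → ℝ | (toK v).PosDef} := by
    have : {v : Fin 5 → ℝ | (toK v).PosDef} = {v | 0 < v 0 - 2 * v 1 + v 3} ∩
        ({v | 0 < v 3 - (v 1 - v 3) ^ 2 / (v 0 - 2 * v 1 + v 3)} ∩
         {v | 0 < v 4 - v 2 ^ 2 / (v 3 - (v 1 - v 3) ^ 2 / (v 0 - 2 * v 1 + v 3))}) := by
      ext v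
      exact posDef_iff' v rfl rfl rfl rfl rfl
    rw [this]
    exact (measurableSet_lt (by fun_prop) (by fun_prop)).inter
      ((measurableSet_lt (by fun_prop) (by fun_prop)).inter
        (measurableSet_lt (by fun_prop) (by fun_prop)))
  rw [← integral_indicator hms]
  simp only [integrand_eq _ D hD hD13]
  rw [integral_eq_lintegral_of_nonneg_ae (Filter.Eventually.of_forall fun v => GG_nonneg _ _ _ _ _ _ _ _ _ _ _)
    hGm.aestronglyMeasurable]
  have hcv := MM_pres.lintegral_comp hGm2
  have hpt : ∀ v : Fin 5 → ℝ, (toLin' MM v) 0 = v 0 - 2 * v 1 + v 3 ∧ (toLin' MM v) 1 = v 1 - v 3 ∧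
      (toLin' MM v) 2 = v 3 ∧ (toLin' MM v) 3 = v 2 ∧ (toLin' MM v) 4 = v 4 := by
    intro v
    simp [MM, mulVec, dotProduct, Fin.sum_univ_succ]
    constructor <;> ring
  simp only [(hpt _).1, (hpt _).2.1, (hpt _).2.2.1, (hpt _).2.2.2.1, (hpt _).2.2.2.2] at hcv
  rw [hcv, lint_five _ hGm2]
  have hst := step_a δ (D 0 0) (D 0 0 + D 0 1) (D 0 0 + D 1 1 + 2 * D 0 1) (D 0 2) (D 2 2) hδ h33 hS hg he
  have hfin := final δ (D 0 0) (D 1 1) (D 0 1) (D 0 2) (D 2 2) hδ h33 hS k1 k2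
  rw [← hfin]
  refine (congrArg ENNReal.toReal hst).trans (ENNReal.toReal_ofReal ?_)
  have hG := Real.Gamma_pos_of_pos (half_pos hδ)
  have hG := Real.Gamma_pos_of_pos (show 0 < (δ + 1) / 2 by positivity)
  positivity
end

section
/- Let P_G be the cone of symmetric positive definite (n+1)×(n+1) arrow matrices l(a,b,c) (with l₁₁ = a, first row/column b ∈ ℝⁿ, remaining diagonal c, zeros elsewhere). For δ ≥ 1 and (a', b', c') with ‖b'‖² < n a' c', a' > 0, c' > 0, the integral ∫_{P_G} (det K)^{(δ-2)/2} exp(-(1/2) tr(K · l(a',b',c'))) dK equals 2^{(δ + nδ + 2)/2} π^{n/2} (a')^{(δ/2 - 1)(n-1)} (n a' c' - ‖b'‖²)^{-((δ-1)n/2 + 1)} Γ((δ-1)n/2 + 1) Γ(δ/2), where dK is Lebesgue measure on the n+2 free coordinates (a, b₁, ..., b_n, c). -/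
open Matrix Real MeasureTheory

/-- The (n+1)×(n+1) arrow (star-graph) matrix. -/
def arrowMatrix (n : ℕ) (a c : ℝ) (b : Fin n → ℝ) : Matrix (Fin (n+1)) (Fin (n+1)) ℝ :=
  Matrix.of fun i j =>
    if hi : i = 0 then (if hj : j = 0 then a else b (j.pred hj))
    else (if hj : j = 0 then b (i.pred hi) else if i = j then c else 0)

theorem arrow_trace (n : ℕ) (a c a' c' : ℝ) (b b' : Fin n → ℝ) :
    (arrowMatrix n a c b * arrowMatrix n a' c' b').trace
      = a * a' + 2 * ∑ j, b j * b' j + n * c * c' := by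
  simp [Matrix.trace, Matrix.mul_apply, Fin.sum_univ_succ, arrowMatrix, Finset.sum_add_distrib]
  ring

theorem arrow_det (n : ℕ) (a c : ℝ) (b : Fin n → ℝ) (hc : 0 < c) :
    (arrowMatrix n a c b).det = c ^ n * (a - (∑ j, (b j)^2) / c) := by
  let e : Unit ⊕ Fin n ≃ Fin (n+1) :=
    (Equiv.sumComm _ _).trans ((Equiv.optionEquivSumPUnit.{0} (Fin n)).symm.trans (finSuccEquiv n).symm)
  have he : (arrowMatrix n a c b).submatrix e e =
      Matrix.fromBlocks (Matrix.of fun _ _ => a) (Matrix.of fun _ j => b j)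
        (Matrix.of fun i _ => b i) (Matrix.diagonal fun _ => c) := by
    ext i j
    rcases i with i | i <;> rcases j with j | j <;>
      simp [e, arrowMatrix, Matrix.diagonal_apply]
  rw [← Matrix.det_submatrix_equiv_self e, he]
  letI : Invertible c := invertibleOfNonzero hc.ne'
  letI : Invertible (fun _ : Fin n => c) := ⟨fun _ => c⁻¹, by ext; simp [hc.ne'], by ext; simp [hc.ne']⟩
  letI : Invertible (Matrix.diagonal fun _ : Fin n => c) := Matrix.diagonalInvertible _
  rw [Matrix.det_fromBlocks₂₂]
  have : (⅟ (Matrix.diagonal fun _ : Fin n => c)) = Matrix.diagonal fun _ => c⁻¹ := by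
    apply invOf_eq_right_inv
    simp [hc.ne']
  rw [this]
  simp [Matrix.mul_apply, Matrix.diagonal_apply, Finset.sum_div]
  left
  apply Finset.sum_congr rfl
  intros
  field_simp

theorem lint_of_int {α : Type*} [MeasurableSpace α] {μ : Measure α} {f : α → ℝ} {v : ℝ}
    (h0 : 0 ≤ᵐ[μ] f) (hv : ∫ x, f x ∂μ = v) (hne : v ≠ 0) :
    ∫⁻ x, ENNReal.ofReal (f x) ∂μ = ENNReal.ofReal v := by
  have hi : Integrable f μ := by
    by_contra h
    exact hne (hv ▸ integral_undef h)
  rw [← hv, ofReal_integral_eq_lintegral_ofReal hi h0]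

theorem lint_gamma (q r : ℝ) (hq : 0 < q) (hr : 0 < r) :
    ∫⁻ t in Set.Ioi (0:ℝ), ENNReal.ofReal (t ^ (q - 1) * rexp (-(r * t)))
      = ENNReal.ofReal ((1 / r) ^ q * Real.Gamma q) := by
  apply lint_of_int
  · filter_upwards [ae_restrict_mem measurableSet_Ioi] with t ht
    have : 0 < t := ht
    simp only [Pi.zero_apply]
    positivity
  · exact Real.integral_rpow_mul_exp_neg_mul_Ioi hq hr
  · have := Real.Gamma_pos_of_pos hq
    positivity

theorem int_gauss1 (k d : ℝ) (hk : 0 < k) :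
    ∫ u : ℝ, rexp (-(k * u ^ 2 + d * u)) = rexp (d ^ 2 / (4 * k)) * √(π / k) := by
  rw [← integral_gaussian k, ← integral_sub_right_eq_self _ (d / (2 * k)), ← integral_const_mul]
  congr 1
  ext u
  rw [← Real.exp_add]
  congr 1
  field_simp
  ring

theorem lint_gauss (n : ℕ) (k : ℝ) (d : Fin n → ℝ) (hk : 0 < k) :
    ∫⁻ u : Fin n → ℝ, ENNReal.ofReal (rexp (-(k * ∑ j, u j ^ 2 + ∑ j, u j * d j)))
      = ENNReal.ofReal (rexp ((∑ j, d j ^ 2) / (4 * k)) * (π / k) ^ ((n : ℝ) / 2)) := by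
  apply lint_of_int
  · exact Filter.Eventually.of_forall fun _ => (Real.exp_pos _).le
  · have : ∀ u : Fin n → ℝ, rexp (-(k * ∑ j, u j ^ 2 + ∑ j, u j * d j))
        = ∏ j, rexp (-(k * u j ^ 2 + d j * u j)) := by
      intro u
      rw [← Real.exp_sum, Finset.sum_neg_distrib, Finset.sum_add_distrib, Finset.mul_sum]
      simp only [mul_comm (d _)]
    simp_rw [this]
    rw [integral_fintype_prod_volume_eq_prod (fun j (t:ℝ) => rexp (-(k * t ^ 2 + d j * t)))]
    simp_rw [int_gauss1 k _ hk]
    rw [Finset.prod_mul_distrib, ← Real.exp_sum, Finset.sum_div]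
    congr 1
    rw [Finset.prod_const, Finset.card_univ, Fintype.card_fin, Real.sqrt_eq_rpow,
      ← Real.rpow_natCast, ← Real.rpow_mul (by positivity)]
    congr 1
    ring
  · positivity

theorem inner_a (p a' c M R : ℝ) (hp : 0 < p + 1) (ha' : 0 < a') (hM : 0 ≤ M) :
    ∫⁻ a : ℝ, Set.indicator {a : ℝ | 0 < a - R} (fun a => ENNReal.ofReal
      (M * (a - R) ^ p * rexp (-(1/2) * (a * a' + c)))) a
      = ENNReal.ofReal (M * rexp (-(1/2) * (R * a' + c)) * ((2 / a') ^ (p+1) * Real.Gamma (p+1))) := by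
  rw [← lintegral_add_right_eq_self _ R, ENNReal.ofReal_mul (by positivity)]
  have h2 : (2 / a') = 1 / (a' / 2) := by field_simp
  rw [h2, ← lint_gamma (p+1) (a'/2) hp (by positivity), ← lintegral_const_mul' _ _ (by simp),
    ← lintegral_indicator measurableSet_Ioi]
  congr 1
  ext s
  by_cases hs : 0 < s
  · rw [Set.indicator_of_mem (by simpa using hs), Set.indicator_of_mem (by simpa using hs),
      ← ENNReal.ofReal_mul (by positivity)]
    congr 1
    rw [mul_assoc M, mul_assoc M]
    congr 1
    rw [mul_left_comm, ← Real.exp_add]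
    congr 2
    · ring
    · ring
    · ring
  · rw [Set.indicator_of_notMem (by simpa using hs), Set.indicator_of_notMem (by simpa using hs)]

theorem normalizing_constant_star_leaves (n : ℕ) (hn : 0 < n) (δ : ℝ) (hδ : 1 ≤ δ)
    (a' c' : ℝ) (b' : Fin n → ℝ) (ha' : 0 < a') (hc' : 0 < c')
    (hb' : ∑ j, (b' j)^2 < n * a' * c') :
    ∫ x in {x : ℝ × (Fin n → ℝ) × ℝ | 0 < x.2.2 ∧
        0 < x.1 - (∑ j, (x.2.1 j)^2) / x.2.2},
        (arrowMatrix n x.1 x.2.2 x.2.1).det ^ ((δ - 2)/2)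
          * Real.exp (-(1/2) * ((arrowMatrix n x.1 x.2.2 x.2.1)
              * arrowMatrix n a' c' b').trace)
      = 2 ^ ((δ + n*δ + 2)/2) * π ^ ((n:ℝ)/2)
          * a' ^ ((δ/2 - 1) * (n - 1 : ℝ))
          * (n * a' * c' - ∑ j, (b' j)^2) ^ (-((δ-1) * n/2 + 1))
          * Real.Gamma ((δ-1) * n/2 + 1) * Real.Gamma (δ/2) := by
  set S := {x : ℝ × (Fin n → ℝ) × ℝ | 0 < x.2.2 ∧
        0 < x.1 - (∑ j, (x.2.1 j)^2) / x.2.2} with hS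
  have hSm : MeasurableSet S := by
    apply MeasurableSet.inter
    · exact measurableSet_lt (f := fun _ => (0:ℝ)) (g := fun x : ℝ × (Fin n → ℝ) × ℝ => x.2.2)
        measurable_const (by fun_prop)
    · exact measurableSet_lt (f := fun _ => (0:ℝ)) (g := fun x : ℝ × (Fin n → ℝ) × ℝ =>
        x.1 - (∑ j, (x.2.1 j)^2) / x.2.2) measurable_const (by fun_prop)
  set p := (δ - 2) / 2 with hp
  have hp1 : 0 < p + 1 := by rw [hp]; linarith
  let g : ℝ × (Fin n → ℝ) × ℝ → ℝ := fun x =>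
    x.2.2 ^ (n * p) * (x.1 - (∑ j, (x.2.1 j)^2) / x.2.2) ^ p *
      rexp (-(1/2) * (x.1 * a' + (2 * ∑ j, x.2.1 j * b' j + n * x.2.2 * c')))
  have hgm : Measurable g := by fun_prop
  rw [setIntegral_congr_fun (g := g) hSm]
  swap
  · rintro x ⟨h1, h2⟩
    simp only [g]
    rw [arrow_trace, arrow_det _ _ _ _ h1, Real.mul_rpow (by positivity) h2.le,
      ← Real.rpow_natCast, ← Real.rpow_mul h1.le, add_assoc]
  rw [integral_eq_lintegral_of_nonneg_ae]
  rotate_left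
  · filter_upwards [ae_restrict_mem hSm] with x hx
    obtain ⟨h1, h2⟩ := hx
    simp only [Pi.zero_apply, g]
    positivity
  · exact hgm.aestronglyMeasurable
  set B := ∑ j, (b' j)^2 with hB
  set D := n * a' * c' - B with hD
  have hD0 : 0 < D := by rw [hD]; linarith
  set q := (δ-1) * n/2 + 1 with hq
  have hq0 : 0 < q := by
    have : 0 ≤ (δ-1) * n := mul_nonneg (by linarith) (by positivity)
    rw [hq]; linarith
  have hG1 := Real.Gamma_pos_of_pos hp1
  have hG2 := Real.Gamma_pos_of_pos hq0
  rw [← lintegral_indicator hSm]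
  have hFm : Measurable (S.indicator fun x => ENNReal.ofReal (g x)) :=
    hgm.ennreal_ofReal.indicator hSm
  rw [Measure.volume_eq_prod, lintegral_prod_symm' _ hFm, Measure.volume_eq_prod,
    lintegral_prod_symm' _ hFm.lintegral_prod_left']
  have key : ∀ c : ℝ, (∫⁻ b : Fin n → ℝ, ∫⁻ a : ℝ, S.indicator (fun x => ENNReal.ofReal (g x)) (a, b, c))
      = (Set.Ioi (0:ℝ)).indicator (fun c => ENNReal.ofReal
        ((2 / a') ^ (p+1) * Real.Gamma (p+1) * (2 * π / a') ^ ((n:ℝ)/2)) * ENNReal.ofReal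
        (c ^ (q - 1) * rexp (-(D / (2 * a') * c)))) c := by
    intro c
    by_cases hc : 0 < c
    · rw [Set.indicator_of_mem (by simpa using hc)]
      have h1 : ∀ b : Fin n → ℝ, (∫⁻ a : ℝ, S.indicator (fun x => ENNReal.ofReal (g x)) (a, b, c))
          = ENNReal.ofReal (c ^ (n * p) * ((2 / a') ^ (p+1) * Real.Gamma (p+1)) * rexp (-(1/2) * (n * c * c')))
            * ENNReal.ofReal (rexp (-(a' / (2 * c) * ∑ j, b j ^ 2 + ∑ j, b j * b' j))) := by
        intro b
        rw [← ENNReal.ofReal_mul (by positivity)]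
        have := inner_a p a' (2 * ∑ j, b j * b' j + n * c * c') (c ^ (n * p))
          ((∑ j, b j ^ 2) / c) hp1 ha' (by positivity)
        convert this using 2
        · ext a
          simp [Set.indicator, hS, hc, g]
        · have e0 : rexp (-(1/2) * ((∑ j, b j ^ 2) / c * a' + (2 * ∑ j, b j * b' j + n * c * c')))
              = rexp (-(1/2) * (n * c * c')) *
                rexp (-(a' / (2 * c) * ∑ j, b j ^ 2 + ∑ j, b j * b' j)) := by
            rw [← Real.exp_add]
            congr 1
            field_simp
            ring
          rw [e0]
          ring
      simp_rw [h1]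
      rw [lintegral_const_mul' _ _ (by simp), lint_gauss n _ _ (by positivity),
        ← ENNReal.ofReal_mul (by positivity), ← ENNReal.ofReal_mul (by positivity)]
      congr 1
      have e1 : (π / (a' / (2 * c))) ^ ((n:ℝ)/2) = (2 * π / a') ^ ((n:ℝ)/2) * c ^ ((n:ℝ)/2) := by
        rw [← Real.mul_rpow (by positivity) hc.le]
        congr 1
        field_simp
      have e2 : c ^ (q - 1) = c ^ (n * p) * c ^ ((n:ℝ)/2) := by
        rw [← Real.rpow_add hc]
        congr 1
        rw [hq, hp]; ring
      have e3 : rexp (-(D / (2 * a') * c)) = rexp (-(1/2) * (n * c * c')) *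
          rexp ((∑ j, b' j ^ 2) / (4 * (a' / (2 * c)))) := by
        rw [← Real.exp_add, ← hB, hD]
        congr 1
        field_simp
        ring
      rw [e1, e2, e3]
      ring
    · rw [Set.indicator_of_notMem (by simpa using hc)]
      simp [Set.indicator, hS, hc]
  simp_rw [key]
  rw [lintegral_indicator measurableSet_Ioi, lintegral_const_mul' _ _ (by simp),
    lint_gamma _ _ hq0 (by positivity), ← ENNReal.ofReal_mul (by positivity),
    ENNReal.toReal_ofReal (by positivity)]
  have f1 : p + 1 = δ / 2 := by rw [hp]; ring
  have f2 : 1 / (D / (2 * a')) = 2 * a' * D⁻¹ := by field_simp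
  rw [f1, f2, Real.mul_rpow (by positivity) (by positivity), Real.mul_rpow (by positivity) (by positivity),
    Real.div_rpow (by positivity) (by positivity), Real.div_rpow (by positivity) (by positivity),
    Real.mul_rpow (by positivity) (by positivity), Real.inv_rpow hD0.le, Real.rpow_neg hD0.le]
  have t2 : (2:ℝ) ^ ((δ + n*δ + 2)/2) = 2 ^ (δ/2) * 2 ^ ((n:ℝ)/2) * 2 ^ q := by
    rw [← Real.rpow_add (by positivity), ← Real.rpow_add (by positivity)]
    congr 1
    rw [hq]; ring
  have t3 : a' ^ ((δ/2 - 1) * (n - 1 : ℝ)) = (a' ^ (δ/2))⁻¹ * (a' ^ ((n:ℝ)/2))⁻¹ * a' ^ q := by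
    rw [← Real.rpow_neg ha'.le, ← Real.rpow_neg ha'.le, ← Real.rpow_add (by positivity), ← Real.rpow_add (by positivity)]
    congr 1
    rw [hq]; ring
  rw [t2, t3]
  ring
end
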